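/- arXiv:1911.10623 — 6 statements merged into one kernel-verified Lean document; each statement's English description precedes it below -/
import Mathlib

section
/- Let 0 < q < p < 1, let A > 1, and suppose there exist α ∈ [0,1) and M > 0 such that |f(x)|·x^α ≤ M for all x ∈ (1, A]. Let F(x) = Σ_{j=0}^∞ (x^{(q/p)^j} − x^{(q/p)^{j+1}}) · f(x^{(q/p)^j / p}) for x ∈ (1, A]. Then for every x ∈ (1, A] one has (F(x^p) − F(x^q))/(x^p − x^q) = f(x); that is, F is a pq-antiderivative of f on (1, A]. -/
/-- The pq-integral of `f` at `x`:
`I_{pq}⁺f(x) = Σ_{j=0}^∞ (x^{(q/p)^j} − x^{(q/p)^{j+1}}) · f(x^{(q/p)^j / p})`. -/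
noncomputable def pqInt (p q : ℝ) (f : ℝ → ℝ) (x : ℝ) : ℝ :=
  ∑' j : ℕ, (x ^ ((q / p) ^ j) - x ^ ((q / p) ^ (j + 1))) * f (x ^ ((q / p) ^ j / p))

/-- The increments of `j ↦ y ^ (r ^ j)` are absolutely summable against a bounded sequence. -/
theorem summable_rpow_pow_sub_mul {y r M : ℝ} (hy : 1 ≤ y) (hr0 : 0 ≤ r) (hr1 : r ≤ 1)
    {c : ℕ → ℝ} (hc : ∀ j, |c j| ≤ M) :
    Summable fun j : ℕ => (y ^ (r ^ j) - y ^ (r ^ (j + 1))) * c j := by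
  have hy0 : 0 < y := by linarith
  have hnonneg (j : ℕ) : 0 ≤ y ^ (r ^ j) - y ^ (r ^ (j + 1)) :=
    sub_nonneg.2 (Real.rpow_le_rpow_of_exponent_le hy
      (pow_le_pow_of_le_one hr0 hr1 j.le_succ))
  have hsum : Summable fun j : ℕ => y ^ (r ^ j) - y ^ (r ^ (j + 1)) := by
    refine summable_of_sum_range_le (c := y ^ (r ^ 0)) hnonneg fun n => ?_
    rw [Finset.sum_range_sub']
    exact sub_le_self _ (Real.rpow_nonneg hy0.le _)
  refine Summable.of_norm_bounded (hsum.mul_right M) fun j => ?_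
  rw [Real.norm_eq_abs, abs_mul, abs_of_nonneg (hnonneg j)]
  exact mul_le_mul_of_nonneg_left (hc j) (hnonneg j)

/-- Substituting `x ^ q` for `x ^ p` shifts the pq-integral series by one term. -/
theorem pqInt_rpow_sub_pqInt_rpow {p q x : ℝ} (f : ℝ → ℝ) (hp : p ≠ 0) (hx : 0 ≤ x)
    (hs : Summable fun j : ℕ =>
      ((x ^ p) ^ ((q / p) ^ j) - (x ^ p) ^ ((q / p) ^ (j + 1))) * f (x ^ ((q / p) ^ j))) :
    pqInt p q f (x ^ p) - pqInt p q f (x ^ q) = (x ^ p - x ^ q) * f x := by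
  have hqr (j : ℕ) : q * (q / p) ^ j = p * (q / p) ^ (j + 1) := by
    rw [pow_succ]; field_simp
  have hF (j : ℕ) : (x ^ p) ^ ((q / p) ^ j / p) = x ^ ((q / p) ^ j) := by
    rw [← Real.rpow_mul hx, mul_div_cancel₀ _ hp]
  have hG (j : ℕ) : (x ^ q) ^ ((q / p) ^ j / p) = x ^ ((q / p) ^ (j + 1)) := by
    rw [← Real.rpow_mul hx, ← mul_div_assoc, hqr, mul_div_cancel_left₀ _ hp]
  have hH (j : ℕ) : (x ^ q) ^ ((q / p) ^ j) = (x ^ p) ^ ((q / p) ^ (j + 1)) := by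
    rw [← Real.rpow_mul hx, ← Real.rpow_mul hx, hqr]
  simp only [pqInt, hF, hG, hH]
  rw [hs.tsum_eq_zero_add, add_sub_cancel_right]
  simp only [pow_zero, zero_add, pow_one, Real.rpow_one]
  rw [← Real.rpow_mul hx, mul_div_cancel₀ _ hp]

/-- If `0 < q < p < 1`, `A > 1` and `|f(x)|·x^α ≤ M` on `(1, A]` for some `α ∈ [0,1)` and
`M > 0`, then the sum `F` of the pq-integral series is a pq-antiderivative of `f` on `(1, A]`:
for every `x ∈ (1, A]`, `(F(x^p) − F(x^q))/(x^p − x^q) = f(x)`. -/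
theorem pqInt_is_antiderivative (p q A : ℝ) (f : ℝ → ℝ)
    (hq : 0 < q) (hqp : q < p) (hp : p < 1) (hA : 1 < A)
    (α M : ℝ) (hα0 : 0 ≤ α) (hα1 : α < 1) (hM : 0 < M)
    (hbound : ∀ x ∈ Set.Ioc (1 : ℝ) A, |f x| * x ^ α ≤ M) :
    ∀ x ∈ Set.Ioc (1 : ℝ) A,
      (pqInt p q f (x ^ p) - pqInt p q f (x ^ q)) / (x ^ p - x ^ q) = f x := by
  rintro x ⟨hx1, hxA⟩
  have hp0 : 0 < p := hq.trans hqp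
  have hx0 : 0 < x := one_pos.trans hx1
  have hr0 : 0 < q / p := div_pos hq hp0
  have hr1 : q / p ≤ 1 := ((div_lt_one hp0).2 hqp).le
  have hf (j : ℕ) : |f (x ^ ((q / p) ^ j))| ≤ M := by
    have h1 : 1 < x ^ ((q / p) ^ j) := Real.one_lt_rpow hx1 (pow_pos hr0 j)
    have hle : x ^ ((q / p) ^ j) ≤ x :=
      Real.rpow_le_self_of_one_le hx1.le (pow_le_one₀ hr0.le hr1)
    exact (le_mul_of_one_le_right (abs_nonneg _) (Real.one_le_rpow h1.le hα0)).trans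
      (hbound _ ⟨h1, hle.trans hxA⟩)
  have hs := summable_rpow_pow_sub_mul (Real.one_le_rpow hx1.le hp0.le) hr0.le hr1 hf
  rw [pqInt_rpow_sub_pqInt_rpow f hp0.ne' hx0.le hs]
  exact mul_div_cancel_left₀ _ (sub_pos.2 (Real.rpow_lt_rpow_of_exponent_lt hx1 hqp)).ne'
end

section
/- Let 0 < q < p < 1, let f : (0,∞) → ℝ, and let x > 1. If the series I_{pq}⁺f(t) = Σ_{j=0}^∞ (t^{(q/p)^j} − t^{(q/p)^{j+1}}) · f(t^{(q/p)^j / p}) converges for t = x^p and for t = x^q, then D_{pq}(I_{pq}⁺f)(x) = (I_{pq}⁺f(x^p) − I_{pq}⁺f(x^q))/(x^p − x^q) = f(x). -/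
/-- The `j`-th term of the pq-integral series of `f` at `x`:
`(x^{(q/p)^j} − x^{(q/p)^{j+1}}) · f(x^{(q/p)^j / p})`. -/
noncomputable def pqIntTerm (p q : ℝ) (f : ℝ → ℝ) (x : ℝ) (j : ℕ) : ℝ :=
  (x ^ ((q / p) ^ j) - x ^ ((q / p) ^ (j + 1))) * f (x ^ ((q / p) ^ j / p))

/-- The term at `x ^ q` is the next term at `x ^ p`. -/
theorem pqIntTerm_rpow_eq_succ {p : ℝ} (q : ℝ) (f : ℝ → ℝ) (hp : p ≠ 0) {x : ℝ} (hx : 0 ≤ x)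
    (j : ℕ) : pqIntTerm p q f (x ^ q) j = pqIntTerm p q f (x ^ p) (j + 1) := by
  have h : ∀ n : ℕ, p * (q / p) ^ (n + 1) = q * (q / p) ^ n := fun n => by
    rw [pow_succ']
    field_simp
  simp only [pqIntTerm, ← Real.rpow_mul hx, h, ← mul_div_assoc]

theorem pqIntTerm_rpow_zero {p : ℝ} (q : ℝ) (f : ℝ → ℝ) (hp : p ≠ 0) {x : ℝ} (hx : 0 ≤ x) :
    pqIntTerm p q f (x ^ p) 0 = (x ^ p - x ^ q) * f x := by
  simp [pqIntTerm, ← Real.rpow_mul hx, mul_div_cancel₀, hp]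

/-- If `0 < q < p < 1`, `x > 1`, and the pq-integral series `I_{pq}⁺f` converges at `x^p`
and at `x^q`, then `D_{pq}(I_{pq}⁺f)(x) = f(x)`. -/
theorem pqDeriv_pqInt (p q : ℝ) (f : ℝ → ℝ)
    (hq : 0 < q) (hqp : q < p) (hp : p < 1) (x : ℝ) (hx : 1 < x)
    (hsp : Summable (fun j : ℕ => pqIntTerm p q f (x ^ p) j))
    (hsq : Summable (fun j : ℕ => pqIntTerm p q f (x ^ q) j)) :
    ((∑' j : ℕ, pqIntTerm p q f (x ^ p) j) - ∑' j : ℕ, pqIntTerm p q f (x ^ q) j) /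
        (x ^ p - x ^ q) = f x := by
  have hp0 : p ≠ 0 := (hq.trans hqp).ne'
  have hx0 : 0 ≤ x := zero_le_one.trans hx.le
  have hne : x ^ p - x ^ q ≠ 0 := (sub_pos.2 (Real.rpow_lt_rpow_of_exponent_lt hx hqp)).ne'
  rw [hsp.tsum_eq_zero_add, pqIntTerm_rpow_zero q f hp0 hx0,
    tsum_congr (pqIntTerm_rpow_eq_succ q f hp0 hx0), add_sub_cancel_right,
    mul_div_cancel_left₀ _ hne]
end

section
/- Let 0 < q < p < 1 and let f : (0,∞)∖{1} → ℝ be given by f(t) = 1/(t^p − t^q). Then for every x > 0 with x ≠ 1, each term of the series Σ_{j=0}^∞ (x^{(q/p)^j} − x^{(q/p)^{j+1}}) · f(x^{(q/p)^j / p}) equals 1, and hence the series diverges. -/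
/-- For `0 < q < p < 1` and `f(t) = 1/(t^p − t^q)`, every term of the pq-integral series
of `f` at any `x > 0`, `x ≠ 1`, equals `1`, and hence the series diverges.  This shows the
boundedness hypothesis in the convergence theorem for the pq-integral cannot be removed. -/
theorem pqInt_not_summable (p q : ℝ) (hq : 0 < q) (hqp : q < p) (hp : p < 1)
    (x : ℝ) (hx : 0 < x) (hx1 : x ≠ 1) :
    (∀ j : ℕ,
      (x ^ ((q / p) ^ j) - x ^ ((q / p) ^ (j + 1))) *
          (1 / ((x ^ ((q / p) ^ j / p)) ^ p - (x ^ ((q / p) ^ j / p)) ^ q)) = 1) ∧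
    ¬ Summable (fun j : ℕ =>
        (x ^ ((q / p) ^ j) - x ^ ((q / p) ^ (j + 1))) *
          (1 / ((x ^ ((q / p) ^ j / p)) ^ p - (x ^ ((q / p) ^ j / p)) ^ q))) := by
  have hp0 : 0 < p := hq.trans hqp
  have term_eq_one : ∀ j : ℕ,
      (x ^ ((q / p) ^ j) - x ^ ((q / p) ^ (j + 1))) *
          (1 / ((x ^ ((q / p) ^ j / p)) ^ p - (x ^ ((q / p) ^ j / p)) ^ q)) = 1 := by
    intro j
    have hpow : (x ^ ((q / p) ^ j / p)) ^ p = x ^ ((q / p) ^ j) := by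
      rw [← Real.rpow_mul hx.le, div_mul_cancel₀ _ hp0.ne']
    have hqpow : (x ^ ((q / p) ^ j / p)) ^ q = x ^ ((q / p) ^ (j + 1)) := by
      rw [← Real.rpow_mul hx.le, pow_succ, div_mul_eq_mul_div, mul_div_assoc]
    have hexp : (q / p) ^ (j + 1) < (q / p) ^ j :=
      pow_lt_pow_right_of_lt_one₀ (div_pos hq hp0) ((div_lt_one hp0).2 hqp) j.lt_succ_self
    rw [hpow, hqpow]
    refine mul_one_div_cancel (sub_ne_zero.2 fun h => hexp.ne' ?_)
    exact (Real.rpow_right_inj hx hx1).1 h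
  refine ⟨term_eq_one, ?_⟩
  simp only [term_eq_one, summable_const_iff]
  exact one_ne_zero
end

section
/- Let 0 < q < p < 1, let f : (0,∞) → ℝ, and let x ∈ (0,1). If the series I_{pq}⁻⁻f(t) = Σ_{j=0}^∞ (t^{(q/p)^{j+1}} − t^{(q/p)^j}) · f(t^{(q/p)^j / p}) converges for t = x^p and for t = x^q, then D_{pq}(I_{pq}⁻⁻f)(x) = (I_{pq}⁻⁻f(x^p) − I_{pq}⁻⁻f(x^q))/(x^p − x^q) = −f(x). -/
/-- The `j`-th term of the series for the definite pq-integral of `f` from `x` to `1`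
(for `0 < x < 1`): `(x^{(q/p)^{j+1}} − x^{(q/p)^j}) · f(x^{(q/p)^j / p})`. -/
noncomputable def pqIntMMTerm (p q : ℝ) (f : ℝ → ℝ) (x : ℝ) (j : ℕ) : ℝ :=
  (x ^ ((q / p) ^ (j + 1)) - x ^ ((q / p) ^ j)) * f (x ^ ((q / p) ^ j / p))

/-- Replacing `x ^ p` by `x ^ q` shifts the terms of the pq-integral series by one. -/
theorem pqIntMMTerm_rpow_right {p : ℝ} (q : ℝ) (f : ℝ → ℝ) (hp : p ≠ 0) {x : ℝ} (hx : 0 ≤ x)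
    (j : ℕ) : pqIntMMTerm p q f (x ^ q) j = pqIntMMTerm p q f (x ^ p) (j + 1) := by
  have key : x ^ q = (x ^ p) ^ (q / p) := by
    rw [← Real.rpow_mul hx, mul_div_cancel₀ _ hp]
  have hxp : 0 ≤ x ^ p := Real.rpow_nonneg hx p
  simp only [pqIntMMTerm, key, ← Real.rpow_mul hxp, mul_div_assoc', ← pow_succ']

/-- The first term of the pq-integral series at `x ^ p`. -/
theorem pqIntMMTerm_rpow_zero {p : ℝ} (q : ℝ) (f : ℝ → ℝ) (hp : p ≠ 0) {x : ℝ} (hx : 0 ≤ x) :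
    pqIntMMTerm p q f (x ^ p) 0 = (x ^ q - x ^ p) * f x := by
  simp only [pqIntMMTerm, ← Real.rpow_mul hx, zero_add, pow_one, pow_zero, mul_one,
    mul_div_cancel₀ _ hp, Real.rpow_one]

/-- If `0 < q < p < 1`, `x ∈ (0,1)`, and the series `I_{pq}⁻⁻f` converges at `x^p` and
at `x^q`, then `D_{pq}(I_{pq}⁻⁻f)(x) = −f(x)`. -/
theorem pqDeriv_pqIntMM (p q : ℝ) (f : ℝ → ℝ)
    (hq : 0 < q) (hqp : q < p) (hp : p < 1)
    (x : ℝ) (hx : x ∈ Set.Ioo (0 : ℝ) 1)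
    (hsp : Summable (fun j : ℕ => pqIntMMTerm p q f (x ^ p) j))
    (hsq : Summable (fun j : ℕ => pqIntMMTerm p q f (x ^ q) j)) :
    ((∑' j : ℕ, pqIntMMTerm p q f (x ^ p) j) - ∑' j : ℕ, pqIntMMTerm p q f (x ^ q) j) /
        (x ^ p - x ^ q) = -f x := by
  have hp0 : p ≠ 0 := (hq.trans hqp).ne'
  have hne : x ^ p - x ^ q ≠ 0 :=
    (sub_neg.mpr (Real.rpow_lt_rpow_of_exponent_gt hx.1 hx.2 hqp)).ne
  rw [hsp.tsum_eq_zero_add, pqIntMMTerm_rpow_zero q f hp0 hx.1.le]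
  simp only [pqIntMMTerm_rpow_right q f hp0 hx.1.le]
  rw [add_sub_cancel_right, div_eq_iff hne]
  ring
end

section
/- Let 0 < q < p < 1, let f : (0,∞) → ℝ, and let x ∈ (0,1). If the series I_{pq}f(t) = Σ_{j=0}^∞ (t^{(p/q)^j} − t^{(p/q)^{j+1}}) · f(t^{(p/q)^j / q}) converges for t = x^p and for t = x^q, then D_{pq}(I_{pq}f)(x) = (I_{pq}f(x^p) − I_{pq}f(x^q))/(x^p − x^q) = f(x). -/
/-- The `j`-th term of the series for the definite pq-integral of `f` from `0` to `x`
(for `0 < x < 1`): `(x^{(p/q)^j} − x^{(p/q)^{j+1}}) · f(x^{(p/q)^j / q})`. -/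
noncomputable def pqIntZeroTerm (p q : ℝ) (f : ℝ → ℝ) (x : ℝ) (j : ℕ) : ℝ :=
  (x ^ ((p / q) ^ j) - x ^ ((p / q) ^ (j + 1))) * f (x ^ ((p / q) ^ j / q))

/-- Shifting the index by one turns the series at `x ^ q` into the series at `x ^ p`. -/
theorem pqIntZeroTerm_rpow_succ {p q : ℝ} (hq : q ≠ 0) (f : ℝ → ℝ) {x : ℝ} (hx : 0 ≤ x) (j : ℕ) :
    pqIntZeroTerm p q f (x ^ q) (j + 1) = pqIntZeroTerm p q f (x ^ p) j := by
  have h (k : ℕ) : q * (p / q) ^ (k + 1) = p * (p / q) ^ k := by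
    rw [pow_succ', ← mul_assoc, mul_div_cancel₀ _ hq]
  simp only [pqIntZeroTerm, ← Real.rpow_mul hx, ← mul_div_assoc, h]

theorem pqIntZeroTerm_rpow_zero {p q : ℝ} (hq : q ≠ 0) (f : ℝ → ℝ) {x : ℝ} (hx : 0 ≤ x) :
    pqIntZeroTerm p q f (x ^ q) 0 = (x ^ q - x ^ p) * f x := by
  simp [pqIntZeroTerm, ← Real.rpow_mul hx, mul_div_cancel₀, hq]

/-- If `0 < q < p < 1`, `x ∈ (0,1)`, and the series `I_{pq}f` converges at `x^p` and at
`x^q`, then `D_{pq}(I_{pq}f)(x) = f(x)`. -/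
theorem pqDeriv_pqIntZero (p q : ℝ) (f : ℝ → ℝ)
    (hq : 0 < q) (hqp : q < p) (hp : p < 1)
    (x : ℝ) (hx : x ∈ Set.Ioo (0 : ℝ) 1)
    (hsp : Summable (fun j : ℕ => pqIntZeroTerm p q f (x ^ p) j))
    (hsq : Summable (fun j : ℕ => pqIntZeroTerm p q f (x ^ q) j)) :
    ((∑' j : ℕ, pqIntZeroTerm p q f (x ^ p) j) - ∑' j : ℕ, pqIntZeroTerm p q f (x ^ q) j) /
        (x ^ p - x ^ q) = f x := by
  have hne : x ^ p - x ^ q ≠ 0 :=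
    (sub_neg.mpr (Real.rpow_lt_rpow_of_exponent_gt hx.1 hx.2 hqp)).ne
  rw [hsq.tsum_eq_zero_add, pqIntZeroTerm_rpow_zero hq.ne' f hx.1.le]
  simp only [pqIntZeroTerm_rpow_succ hq.ne' f hx.1.le]
  rw [div_eq_iff hne]
  ring
end

section
/- (Convergence of the improper pq-integral.) Let 0 < q < p < 1, set b = p/q > 1, and let f : (0,∞) → ℝ. Suppose (i) there exist α ∈ [0,1) and M > 0 such that |f(x)| ≤ M·x^{−α} for all x ∈ (1, b^{1/p}], and (ii) there exist β < 0 and X > 1 such that |f(x)| ≤ |x^{1/p} − x^{1/q}|^{−1} · (ln x)^{2β} for all x ≥ X. Then both series Σ_{j=0}^∞ (b^{(q/p)^j} − b^{(q/p)^{j+1}}) · f(b^{(q/p)^j / p}) and Σ_{j=1}^∞ (b^{(p/q)^j} − b^{(p/q)^{j+1}}) · f(b^{p·(p/q)^j}) converge absolutely; hence the improper pq-integral of f on [1, ∞), defined as the sum of these two series, converges. -/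
theorem Antitone.summable_sub_succ {g : ℕ → ℝ} (hg : Antitone g) (hbdd : BddBelow (Set.range g)) :
    Summable fun j => g j - g (j + 1) := by
  obtain ⟨c, hc⟩ := hbdd
  refine summable_of_sum_range_le (c := g 0 - c)
    (fun j => sub_nonneg.2 (hg j.le_succ)) fun n => ?_
  rw [Finset.sum_range_sub']
  linarith [hc (Set.mem_range_self n)]

/-- The logarithm of `b ^ (p * b ^ (j + 1))`, raised to a negative power, is geometric in `j`. -/
theorem summable_log_rpow_geometric {b p s : ℝ} (hb : 1 < b) (hp : 0 < p) (hs : s < 0) :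
    Summable fun j : ℕ => Real.log (b ^ (p * b ^ (j + 1))) ^ s := by
  have hb0 : 0 < b := one_pos.trans hb
  have hlog : 0 < Real.log b := Real.log_pos hb
  have hgeom : Summable fun j : ℕ => (p * b * Real.log b) ^ s * (b ^ s) ^ j :=
    (summable_geometric_of_lt_one (by positivity)
      (Real.rpow_lt_one_of_one_lt_of_neg hb hs)).mul_left _
  refine hgeom.congr fun j => ?_
  rw [Real.log_rpow hb0, show p * b ^ (j + 1) * Real.log b = p * b * Real.log b * b ^ j by ring,
    Real.mul_rpow (x := p * b * Real.log b) (y := b ^ j) (by positivity) (by positivity),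
    Real.rpow_pow_comm hb0.le]


/-- Convergence of the improper pq-integral on `[1,∞)`.  Let `0 < q < p < 1` and
`b = p/q > 1`.  If `|f(x)| ≤ M·x^{−α}` near `x = 1` (on `(1, b^{1/p}]`) for some
`α ∈ [0,1)`, `M > 0`, and `|f(x)| ≤ |x^{1/p} − x^{1/q}|⁻¹·(ln x)^{2β}` for all
sufficiently large `x` (with `β < 0`),  then both series
`Σ_{j=0}^∞ (b^{(q/p)^j} − b^{(q/p)^{j+1}}) · f(b^{(q/p)^j / p})` and
`Σ_{j=1}^∞ (b^{(p/q)^j} − b^{(p/q)^{j+1}}) · f(b^{p·(p/q)^j})` converge absolutely;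
hence the improper pq-integral `∫_1^∞ f d_{pq}x`, the sum of the two series, converges. -/
theorem improper_pqInt_converges (p q : ℝ) (f : ℝ → ℝ)
    (hq : 0 < q) (hqp : q < p) (hp : p < 1)
    (α M : ℝ) (hα0 : 0 ≤ α) (hα1 : α < 1) (hM : 0 < M)
    (hnear : ∀ x ∈ Set.Ioc (1 : ℝ) ((p / q) ^ (1 / p)), |f x| ≤ M * x ^ (-α))
    (β X : ℝ) (hβ : β < 0) (hX : 1 < X)
    (hfar : ∀ x : ℝ, X ≤ x →
      |f x| ≤ |x ^ (1 / p) - x ^ (1 / q)|⁻¹ * Real.log x ^ (2 * β)) :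
    Summable (fun j : ℕ =>
      |((p / q) ^ ((q / p) ^ j) - (p / q) ^ ((q / p) ^ (j + 1))) *
        f ((p / q) ^ ((q / p) ^ j / p))|) ∧
    Summable (fun j : ℕ =>
      |((p / q) ^ ((p / q) ^ (j + 1)) - (p / q) ^ ((p / q) ^ (j + 2))) *
        f ((p / q) ^ (p * (p / q) ^ (j + 1)))|) := by
  have hp0 : 0 < p := hq.trans hqp
  have hb : 1 < p / q := (one_lt_div hq).2 hqp
  have hb0 : 0 < p / q := one_pos.trans hb
  have hr0 : 0 < q / p := div_pos hq hp0
  have hr1 : q / p ≤ 1 := ((div_lt_one hp0).2 hqp).le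
  constructor
  · have hanti : Antitone fun j : ℕ => (p / q) ^ ((q / p) ^ j) := fun i j hij =>
      Real.rpow_le_rpow_of_exponent_le hb.le (pow_le_pow_of_le_one hr0.le hr1 hij)
    have hbdd : BddBelow (Set.range fun j : ℕ => (p / q) ^ ((q / p) ^ j)) := by
      refine ⟨0, ?_⟩
      rintro _ ⟨j, rfl⟩
      positivity
    refine Summable.of_nonneg_of_le (fun _ => abs_nonneg _) (fun j => ?_)
      ((hanti.summable_sub_succ hbdd).mul_right M)
    have hx : 1 < (p / q) ^ ((q / p) ^ j / p) := Real.one_lt_rpow hb (by positivity)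
    have hx' : (p / q) ^ ((q / p) ^ j / p) ≤ (p / q) ^ (1 / p) :=
      Real.rpow_le_rpow_of_exponent_le hb.le
        (div_le_div_of_nonneg_right (pow_le_one₀ hr0.le hr1) hp0.le)
    have hdiff := sub_nonneg.2 (hanti j.le_succ)
    rw [abs_mul, abs_of_nonneg hdiff]
    refine mul_le_mul_of_nonneg_left ((hnear _ ⟨hx, hx'⟩).trans ?_) hdiff
    exact mul_le_of_le_one_right hM.le
      (Real.rpow_le_one_of_one_le_of_nonpos hx.le (neg_nonpos.2 hα0))
  · refine Summable.of_norm_bounded_eventually_nat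
      (summable_log_rpow_geometric hb hp0 (by linarith : 2 * β < 0)) ?_
    have hlim : Filter.Tendsto (fun j : ℕ => (p / q) ^ (p * (p / q) ^ (j + 1)))
        Filter.atTop Filter.atTop :=
      (tendsto_rpow_atTop_of_base_gt_one _ hb).comp
        (((tendsto_pow_atTop_atTop_of_one_lt hb).comp
          (Filter.tendsto_add_atTop_nat 1)).const_mul_atTop hp0)
    filter_upwards [hlim.eventually_ge_atTop X] with j hj
    have hfx := hfar _ hj
    have hexp_p : p * (p / q) ^ (j + 1) * (1 / p) = (p / q) ^ (j + 1) := by field_simp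
    have hexp_q : p * (p / q) ^ (j + 1) * (1 / q) = (p / q) ^ (j + 2) := by ring
    rw [← Real.rpow_mul hb0.le, ← Real.rpow_mul hb0.le, hexp_p, hexp_q] at hfx
    have hne : (p / q) ^ ((p / q) ^ (j + 1)) - (p / q) ^ ((p / q) ^ (j + 2)) ≠ 0 :=
      (sub_neg.2 (Real.rpow_lt_rpow_of_exponent_lt hb
        (pow_lt_pow_right₀ hb (Nat.lt_succ_self (j + 1))))).ne
    rw [Real.norm_eq_abs, abs_abs, abs_mul]
    exact (le_inv_mul_iff₀ (abs_pos.2 hne)).1 hfx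
end
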